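/- Let q⁽⁰⁾ ∈ K_q have q⁽⁰⁾_{j|x} > 0 for every pair with x ∈ j (i.e., q⁽⁰⁾ lies in the relative interior of K_q), and define recursively r⁽ⁿ⁾ := R(q⁽ⁿ⁾) and q⁽ⁿ⁺¹⁾ := Q(r⁽ⁿ⁾). Then A_x(r⁽ⁿ⁾) > 0 for all x and n (so the iteration is well defined), the sequence φ(q⁽ⁿ⁾, r⁽ⁿ⁾) is nonincreasing, and it converges as n → ∞ to min over (q,r) ∈ K_q × K_r of φ(q,r). -/

import Mathlib

noncomputable section

open Finset

variable {X Y J : Type*}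

/-- `f(u,v) = u·log u − u·log v` with the conventions `f(0,v) = 0` and `f(u,0) = +∞` for `u > 0`,
taking values in the extended reals. -/
def fdiv (u v : ℝ) : EReal :=
  if u = 0 then 0
  else if v = 0 then (⊤ : EReal)
  else ((u * Real.log u - u * Real.log v : ℝ) : EReal)

/-- Marginal `p_x := ∑_y p_{x,y}`. -/
def margX [Fintype Y] (p : X → Y → ℝ) (x : X) : ℝ := ∑ y, p x y

/-- Marginal `p^y := ∑_x p_{x,y}`. -/
def margY [Fintype X] (p : X → Y → ℝ) (y : Y) : ℝ := ∑ x, p x y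

/-- The polytope `K_q`: `q_{j|x} ≥ 0`, `∑_{j∋x} q_{j|x} = 1` for every `x`,
and `q_{j|x} = 0` whenever `x ∉ j`. -/
def Kq [Fintype J] [DecidableEq X] (S : J → Finset X) : Set (J → X → ℝ) :=
  {q | (∀ j x, 0 ≤ q j x) ∧ (∀ x, (∑ j, if x ∈ S j then q j x else 0) = 1) ∧
    (∀ j x, x ∉ S j → q j x = 0)}

/-- The polytope `K_r`: `r_{j|y} ≥ 0` and `∑_j r_{j|y} = 1` for every `y`. -/
def Kr (J Y : Type*) [Fintype J] : Set (J → Y → ℝ) :=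
  {r | (∀ j y, 0 ≤ r j y) ∧ ∀ y, (∑ j, r j y) = 1}

/-- `φ(q,r) := ∑_{x,y,j} p_{x,y} · f(q_{j|x}, r_{j|y})`, extended-real valued. -/
def phi [Fintype X] [Fintype Y] [Fintype J] (p : X → Y → ℝ)
    (q : J → X → ℝ) (r : J → Y → ℝ) : EReal :=
  ∑ x, ∑ y, ∑ j, (p x y : EReal) * fdiv (q j x) (r j y)

/-- `δ(q,q') := ∑_x p_x ∑_{j∋x} f(q_{j|x}, q'_{j|x})`, extended-real valued. -/
def delta [Fintype X] [Fintype Y] [Fintype J] [DecidableEq X] (p : X → Y → ℝ)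
    (S : J → Finset X) (q q' : J → X → ℝ) : EReal :=
  ∑ x, (margX p x : EReal) * ∑ j, (if x ∈ S j then fdiv (q j x) (q' j x) else 0)

/-- `R_{j|y}(q) := ∑_{x∈j} p_{x|y} q_{j|x}`. -/
def Rmap [Fintype X] [Fintype Y] [DecidableEq X] (p : X → Y → ℝ) (S : J → Finset X)
    (q : J → X → ℝ) : J → Y → ℝ :=
  fun j y => ∑ x, if x ∈ S j then (p x y / margY p y) * q j x else 0

/-- `A_x(r) := ∑_{j∋x} ∏_y (r_{j|y})^{p^{y|x}}` (real powers, with `0^0 = 1`). -/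
def Afun [Fintype Y] [Fintype J] [DecidableEq X] (p : X → Y → ℝ) (S : J → Finset X)
    (r : J → Y → ℝ) (x : X) : ℝ :=
  ∑ j, if x ∈ S j then (∏ y, r j y ^ (p x y / margX p x)) else 0

/-- `Q_{j|x}(r) := (∏_y (r_{j|y})^{p^{y|x}}) / A_x(r)` if `x ∈ j`, and `0` otherwise. -/
def Qmap [Fintype Y] [Fintype J] [DecidableEq X] (p : X → Y → ℝ) (S : J → Finset X)
    (r : J → Y → ℝ) : J → X → ℝ :=
  fun j x => if x ∈ S j then (∏ y, r j y ^ (p x y / margX p x)) / Afun p S r x else 0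

open Classical in
/-- `φ_r(r) := −∑_x p_x log A_x(r)`, equal to `+∞` if `A_x(r) = 0` for some `x`. -/
def phiR [Fintype X] [Fintype Y] [Fintype J] [DecidableEq X] (p : X → Y → ℝ)
    (S : J → Finset X) (r : J → Y → ℝ) : EReal :=
  if ∃ x, Afun p S r x = 0 then ⊤
  else (((- ∑ x, margX p x * Real.log (Afun p S r x)) : ℝ) : EReal)

/-- The explicit real-valued formula for `φ_q`:
`∑_x p_x ∑_{j∋x} q_{j|x} log q_{j|x} − ∑_y p^y ∑_j R_{j|y}(q) log R_{j|y}(q)`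
(with the convention `0·log 0 = 0`, automatic since `Real.log 0 = 0`). -/
def phiQexp [Fintype X] [Fintype Y] [Fintype J] [DecidableEq X] (p : X → Y → ℝ)
    (S : J → Finset X) (q : J → X → ℝ) : ℝ :=
  (∑ x, margX p x * ∑ j, if x ∈ S j then q j x * Real.log (q j x) else 0)
    - ∑ y, margY p y * ∑ j, Rmap p S q j y * Real.log (Rmap p S q j y)

/-- The convex corner `K_a := {a : 0 ≤ a_x ≤ A_x(r) (∀x) for some r ∈ K_r}`. -/
def Ka [Fintype X] [Fintype Y] [Fintype J] [DecidableEq X] (p : X → Y → ℝ)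
    (S : J → Finset X) : Set (X → ℝ) :=
  {a | ∃ r ∈ Kr J Y, ∀ x, 0 ≤ a x ∧ a x ≤ Afun p S r x}

open Classical in
/-- `φ_a(a) := −∑_x p_x log a_x`, equal to `+∞` if `a_x = 0` for some `x`. -/
def phiA [Fintype X] [Fintype Y] (p : X → Y → ℝ) (a : X → ℝ) : EReal :=
  if ∃ x, a x = 0 then ⊤
  else (((- ∑ x, margX p x * Real.log (a x)) : ℝ) : EReal)

theorem EReal.coe_finsetSum {ι : Type*} (s : Finset ι) (f : ι → ℝ) :
    ((∑ i ∈ s, f i : ℝ) : EReal) = ∑ i ∈ s, (f i : EReal) :=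
  map_sum (⟨⟨Real.toEReal, EReal.coe_zero⟩, EReal.coe_add⟩ : ℝ →+ EReal) f s

theorem EReal.sum_ne_bot {ι : Type*} {s : Finset ι} {f : ι → EReal} (h : ∀ i ∈ s, f i ≠ ⊥) :
    ∑ i ∈ s, f i ≠ ⊥ :=
  Finset.sum_induction f (fun a => a ≠ ⊥) (fun _ _ ha hb => EReal.add_ne_bot_iff.2 ⟨ha, hb⟩)
    EReal.zero_ne_bot h

theorem EReal.sum_eq_top {ι : Type*} {s : Finset ι} {f : ι → EReal} (h : ∀ i ∈ s, f i ≠ ⊥)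
    {i : ι} (hi : i ∈ s) (hf : f i = ⊤) : ∑ i ∈ s, f i = ⊤ := by
  classical
  rw [← Finset.add_sum_erase s f hi, hf]
  exact EReal.top_add_of_ne_bot (EReal.sum_ne_bot fun k hk => h k (Finset.mem_of_mem_erase hk))

/-- The scalar Gibbs inequality `a log a − a log b ≥ a − b`. -/
theorem sub_le_mul_log_sub_mul_log {a b : ℝ} (ha : 0 ≤ a) (hb : 0 ≤ b) (h : b = 0 → a = 0) :
    a - b ≤ a * Real.log a - a * Real.log b := by
  rcases ha.eq_or_lt with rfl | ha
  · simpa using hb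
  · have hb' : 0 < b := hb.lt_of_ne fun h0 => ha.ne' (h h0.symm)
    have h1 := Real.log_le_sub_one_of_pos (div_pos hb' ha)
    rw [Real.log_div hb'.ne' ha.ne'] at h1
    have h2 := mul_le_mul_of_nonneg_left h1 ha.le
    have h3 : a * (b / a - 1) = b - a := by field_simp
    nlinarith

/-- The Gibbs inequality for finitely supported weights of equal mass. -/
theorem sum_mul_log_sub_mul_log_nonneg {ι : Type*} [Fintype ι] {a b : ι → ℝ} (ha : ∀ i, 0 ≤ a i)
    (hb : ∀ i, 0 ≤ b i) (h : ∀ i, b i = 0 → a i = 0) (hab : ∑ i, a i = ∑ i, b i) :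
    0 ≤ ∑ i, (a i * Real.log (a i) - a i * Real.log (b i)) := by
  have h1 : ∑ i, (a i - b i) ≤ ∑ i, (a i * Real.log (a i) - a i * Real.log (b i)) :=
    Finset.sum_le_sum fun i _ => sub_le_mul_log_sub_mul_log (ha i) (hb i) (h i)
  rwa [Finset.sum_sub_distrib, hab, sub_self] at h1

/-- The weighted log-sum inequality. -/
theorem log_sum_le {ι : Type*} [Fintype ι] {w u v : ι → ℝ} (hw : ∀ i, 0 ≤ w i)
    (hu : ∀ i, 0 ≤ u i) (hv : ∀ i, 0 ≤ v i) (h : ∀ i, v i = 0 → u i = 0) :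
    (∑ i, w i * u i) * Real.log (∑ i, w i * u i)
        - (∑ i, w i * u i) * Real.log (∑ i, w i * v i)
      ≤ ∑ i, w i * (u i * Real.log (u i) - u i * Real.log (v i)) := by
  set U := ∑ i, w i * u i with hU
  set V := ∑ i, w i * v i with hV
  have hU0 : 0 ≤ U := Finset.sum_nonneg fun i _ => mul_nonneg (hw i) (hu i)
  have hV0 : 0 ≤ V := Finset.sum_nonneg fun i _ => mul_nonneg (hw i) (hv i)
  have hwu : U = 0 → ∀ i, w i * u i = 0 := fun h0 i =>
    (Finset.sum_eq_zero_iff_of_nonneg fun i _ => mul_nonneg (hw i) (hu i)).1 h0 i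
      (Finset.mem_univ i)
  rcases hU0.eq_or_lt with h0 | hUpos
  · have : ∑ i, w i * (u i * Real.log (u i) - u i * Real.log (v i)) = 0 :=
      Finset.sum_eq_zero fun i _ => by
        linear_combination (Real.log (u i) - Real.log (v i)) * hwu h0.symm i
    rw [this, ← h0]
    simp
  have hVpos : 0 < V := by
    refine hV0.lt_of_ne fun h0 => hUpos.ne' (Finset.sum_eq_zero fun i _ => ?_)
    have := (Finset.sum_eq_zero_iff_of_nonneg fun i _ => mul_nonneg (hw i) (hv i)).1 h0.symm i
      (Finset.mem_univ i)
    rcases mul_eq_zero.1 this with h1 | h1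
    · simp [h1]
    · simp [h i h1]
  have key : ∀ i, w i * (u i - v i * (U / V)) ≤
      w i * (u i * Real.log (u i) - u i * Real.log (v i))
        - w i * u i * (Real.log U - Real.log V) := by
    intro i
    have h1 := sub_le_mul_log_sub_mul_log (hu i)
      (mul_nonneg (hv i) (div_nonneg hUpos.le hVpos.le)) (fun h0 => h i (by
        rcases mul_eq_zero.1 h0 with h2 | h2
        · exact h2
        · exact absurd h2 (div_pos hUpos hVpos).ne'))
    have h2 : u i * Real.log (v i * (U / V)) =
        u i * (Real.log (v i) + (Real.log U - Real.log V)) := by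
      by_cases hvi : v i = 0
      · simp [h i hvi]
      · rw [Real.log_mul hvi (div_pos hUpos hVpos).ne', Real.log_div hUpos.ne' hVpos.ne']
    rw [h2] at h1
    nlinarith [mul_le_mul_of_nonneg_left h1 (hw i)]
  have h1 := Finset.sum_le_sum fun i (_ : i ∈ Finset.univ) => key i
  have h2 : ∑ i, w i * (u i - v i * (U / V)) = 0 := by
    have : ∑ i, w i * (u i - v i * (U / V)) = U - V * (U / V) := by
      rw [hU, hV, Finset.sum_mul, ← Finset.sum_sub_distrib]
      exact Finset.sum_congr rfl fun i _ => by ring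
    rw [this]
    field_simp
    ring
  rw [h2, Finset.sum_sub_distrib, ← Finset.sum_mul, ← hU] at h1
  linarith

/-- The real-valued version of `phi`, meaningful where `phi` is finite. -/
def phiReal [Fintype X] [Fintype Y] [Fintype J] (p : X → Y → ℝ)
    (q : J → X → ℝ) (r : J → Y → ℝ) : ℝ :=
  ∑ x, ∑ y, ∑ j, p x y * (q j x * Real.log (q j x) - q j x * Real.log (r j y))

/-- The conditional relative entropy `∑_x p_x ∑_j (q log q − q log q')`. -/
def condRelEntropy [Fintype X] [Fintype Y] [Fintype J] (p : X → Y → ℝ)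
    (q q' : J → X → ℝ) : ℝ :=
  ∑ x, margX p x * ∑ j, (q j x * Real.log (q j x) - q j x * Real.log (q' j x))

theorem sum_eq_one_of_mem_Kq [Fintype J] [DecidableEq X] {S : J → Finset X} {q : J → X → ℝ}
    (hq : q ∈ Kq S) (x : X) : ∑ j, q j x = 1 := by
  rw [← hq.2.1 x]
  refine Finset.sum_congr rfl fun j _ => ?_
  split_ifs with h
  · rfl
  · exact hq.2.2 j x h

section Qmap

variable [Fintype Y] [Fintype J] {p : X → Y → ℝ} {r : J → Y → ℝ}

theorem prod_rpow_pos (hr : r ∈ Kr J Y) {j : J} {x : X}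
    (h : ∀ y, p x y ≠ 0 → r j y ≠ 0) :
    0 < ∏ y, r j y ^ (p x y / margX p x) := by
  refine Finset.prod_pos fun y _ => ?_
  by_cases h0 : p x y = 0
  · simp [h0]
  · exact Real.rpow_pos_of_pos ((hr.1 j y).lt_of_ne (h y h0).symm) _

theorem log_prod_rpow (hr : r ∈ Kr J Y) {j : J} {x : X}
    (h : ∀ y, p x y ≠ 0 → r j y ≠ 0) :
    Real.log (∏ y, r j y ^ (p x y / margX p x)) =
      ∑ y, p x y / margX p x * Real.log (r j y) := by
  have hterm : ∀ y, r j y ^ (p x y / margX p x) ≠ 0 ∧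
      Real.log (r j y ^ (p x y / margX p x)) = p x y / margX p x * Real.log (r j y) := by
    intro y
    by_cases h0 : p x y = 0
    · simp [h0]
    · have hpos := (hr.1 j y).lt_of_ne (h y h0).symm
      exact ⟨(Real.rpow_pos_of_pos hpos _).ne', Real.log_rpow hpos _⟩
  rw [Real.log_prod fun y _ => (hterm y).1]
  exact Finset.sum_congr rfl fun y _ => (hterm y).2

variable [DecidableEq X] {S : J → Finset X}

theorem Afun_pos (hr : r ∈ Kr J Y) (h : ∀ x y j, x ∈ S j → p x y ≠ 0 → r j y ≠ 0)
    (hcov : ∀ x, ∃ j, x ∈ S j) (x : X) : 0 < Afun p S r x := by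
  obtain ⟨j, hj⟩ := hcov x
  have hpos : ∀ j, x ∈ S j → 0 < ∏ y, r j y ^ (p x y / margX p x) := fun j hj =>
    prod_rpow_pos hr fun y => h x y j hj
  refine Finset.sum_pos' (fun j _ => ?_) ⟨j, Finset.mem_univ j, ?_⟩
  · split_ifs with hj
    · exact (hpos j hj).le
    · exact le_rfl
  · rw [if_pos hj]
    exact hpos j hj

theorem Qmap_pos (hr : r ∈ Kr J Y) (h : ∀ x y j, x ∈ S j → p x y ≠ 0 → r j y ≠ 0)
    (hcov : ∀ x, ∃ j, x ∈ S j) {j : J} {x : X} (hj : x ∈ S j) :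
    0 < Qmap p S r j x := by
  rw [Qmap, if_pos hj]
  exact div_pos (prod_rpow_pos hr fun y => h x y j hj) (Afun_pos hr h hcov x)

theorem Qmap_mem_Kq (hr : r ∈ Kr J Y) (h : ∀ x y j, x ∈ S j → p x y ≠ 0 → r j y ≠ 0)
    (hcov : ∀ x, ∃ j, x ∈ S j) : Qmap p S r ∈ Kq S := by
  refine ⟨fun j x => ?_, fun x => ?_, fun j x hj => if_neg hj⟩
  · by_cases hj : x ∈ S j
    · exact (Qmap_pos hr h hcov hj).le
    · exact (if_neg hj).ge
  · have hA := Afun_pos hr h hcov x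
    rw [← div_self hA.ne']
    conv_rhs => rw [Afun, Finset.sum_div]
    refine Finset.sum_congr rfl fun j _ => ?_
    by_cases hj : x ∈ S j
    · simp only [Qmap, if_pos hj, Afun]
    · simp only [if_neg hj, zero_div]

end Qmap

section Alternating

variable [Fintype X] [Fintype Y] [Fintype J] {p : X → Y → ℝ}

theorem phi_eq_phiReal {q : J → X → ℝ} {r : J → Y → ℝ}
    (h : ∀ x y j, p x y ≠ 0 → q j x ≠ 0 → r j y ≠ 0) : phi p q r = (phiReal p q r : EReal) := by
  have hterm : ∀ x y j, (p x y : EReal) * fdiv (q j x) (r j y) =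
      ((p x y * (q j x * Real.log (q j x) - q j x * Real.log (r j y)) : ℝ) : EReal) := by
    intro x y j
    unfold fdiv
    split_ifs with h1 h2
    · simp [h1]
    · have : p x y = 0 := by
        by_contra h3
        exact h x y j h3 h1 h2
      simp [this]
    · rw [← EReal.coe_mul]
  simp only [phi, phiReal, hterm, EReal.coe_finsetSum]

theorem phi_eq_top (hp : ∀ x y, 0 ≤ p x y) {q : J → X → ℝ} {r : J → Y → ℝ} {x : X} {y : Y} {j : J}
    (h1 : p x y ≠ 0) (h2 : q j x ≠ 0) (h3 : r j y = 0) : phi p q r = ⊤ := by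
  have hbot : ∀ x y j, (p x y : EReal) * fdiv (q j x) (r j y) ≠ ⊥ := by
    intro x y j
    unfold fdiv
    split_ifs
    · simp
    · rcases (hp x y).eq_or_lt with h | h
      · simp [← h]
      · simp [EReal.coe_mul_top_of_pos h]
    · rw [← EReal.coe_mul]
      exact EReal.coe_ne_bot _
  have htop : (p x y : EReal) * fdiv (q j x) (r j y) = ⊤ := by
    rw [fdiv, if_neg h2, if_pos h3]
    exact EReal.coe_mul_top_of_pos ((hp x y).lt_of_ne h1.symm)
  have hy : ∀ x y, ∑ j, (p x y : EReal) * fdiv (q j x) (r j y) ≠ ⊥ := fun x y =>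
    EReal.sum_ne_bot fun j _ => hbot x y j
  exact EReal.sum_eq_top (fun x _ => EReal.sum_ne_bot fun y _ => hy x y) (Finset.mem_univ x)
    (EReal.sum_eq_top (fun y _ => hy x y) (Finset.mem_univ y)
      (EReal.sum_eq_top (fun j _ => hbot x y j) (Finset.mem_univ j) htop))

theorem condRelEntropy_self (q : J → X → ℝ) : condRelEntropy p q q = 0 := by
  simp [condRelEntropy]

variable [DecidableEq X] {S : J → Finset X}

theorem Rmap_eq {q : J → X → ℝ} (hq : q ∈ Kq S) (j : J) (y : Y) :
    Rmap p S q j y = ∑ x, (p x y / margY p y) * q j x := by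
  refine Finset.sum_congr rfl fun x _ => ?_
  split_ifs with h
  · rfl
  · simp [hq.2.2 j x h]

theorem margY_mul_Rmap (hpy : ∀ y, 0 < margY p y) {q : J → X → ℝ} (hq : q ∈ Kq S) (j : J) (y : Y) :
    margY p y * Rmap p S q j y = ∑ x, p x y * q j x := by
  rw [Rmap_eq hq, Finset.mul_sum]
  refine Finset.sum_congr rfl fun x _ => ?_
  have := (hpy y).ne'
  field_simp

theorem Rmap_mem_Kr (hp : ∀ x y, 0 ≤ p x y) (hpy : ∀ y, 0 < margY p y) {q : J → X → ℝ}
    (hq : q ∈ Kq S) : Rmap p S q ∈ Kr J Y := by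
  refine ⟨fun j y => ?_, fun y => ?_⟩
  · rw [Rmap_eq hq]
    exact Finset.sum_nonneg fun x _ => mul_nonneg (div_nonneg (hp x y) (hpy y).le) (hq.1 j x)
  · refine mul_left_cancel₀ (hpy y).ne' ?_
    rw [Finset.mul_sum, Finset.sum_congr rfl fun j _ => margY_mul_Rmap hpy hq j y,
      Finset.sum_comm]
    simp_rw [← Finset.mul_sum, sum_eq_one_of_mem_Kq hq]
    simp [margY]

theorem Rmap_ne_zero (hp : ∀ x y, 0 ≤ p x y) (hpy : ∀ y, 0 < margY p y) {q : J → X → ℝ}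
    (hq : q ∈ Kq S) {x : X} {y : Y} {j : J} (h1 : p x y ≠ 0) (h2 : q j x ≠ 0) :
    Rmap p S q j y ≠ 0 := by
  intro h
  have h3 := margY_mul_Rmap hpy hq j y
  rw [h, mul_zero] at h3
  have := (Finset.sum_eq_zero_iff_of_nonneg fun x _ => mul_nonneg (hp x y) (hq.1 j x)).1 h3.symm x
    (Finset.mem_univ x)
  exact mul_ne_zero h1 h2 this

theorem phi_Rmap (hp : ∀ x y, 0 ≤ p x y) (hpy : ∀ y, 0 < margY p y) {q : J → X → ℝ}
    (hq : q ∈ Kq S) : phi p q (Rmap p S q) = (phiReal p q (Rmap p S q) : EReal) :=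
  phi_eq_phiReal fun _ _ _ => Rmap_ne_zero hp hpy hq

/-- Replacing `R(q)` by `r` in the second argument changes `phiReal` by an average of relative
entropies. -/
theorem phiReal_sub_phiReal_Rmap (hpy : ∀ y, 0 < margY p y) {q : J → X → ℝ} (hq : q ∈ Kq S)
    (r : J → Y → ℝ) :
    phiReal p q r - phiReal p q (Rmap p S q) = ∑ y, margY p y * ∑ j,
      (Rmap p S q j y * Real.log (Rmap p S q j y) - Rmap p S q j y * Real.log (r j y)) := by
  have h : ∀ y j, margY p y *
      (Rmap p S q j y * Real.log (Rmap p S q j y) - Rmap p S q j y * Real.log (r j y)) =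
      ∑ x, p x y * q j x * (Real.log (Rmap p S q j y) - Real.log (r j y)) := by
    intro y j
    rw [← Finset.sum_mul, ← margY_mul_Rmap hpy hq]
    ring
  simp_rw [Finset.mul_sum, h]
  rw [Finset.sum_congr rfl fun y _ => Finset.sum_comm, Finset.sum_comm, phiReal, phiReal]
  simp_rw [← Finset.sum_sub_distrib]
  refine Finset.sum_congr rfl fun x _ => Finset.sum_congr rfl fun y _ =>
    Finset.sum_congr rfl fun j _ => ?_
  ring

theorem phiReal_Rmap_le (hp : ∀ x y, 0 ≤ p x y) (hpy : ∀ y, 0 < margY p y) {q : J → X → ℝ}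
    (hq : q ∈ Kq S) {r : J → Y → ℝ} (hr : r ∈ Kr J Y)
    (h : ∀ x y j, p x y ≠ 0 → q j x ≠ 0 → r j y ≠ 0) :
    phiReal p q (Rmap p S q) ≤ phiReal p q r := by
  rw [← sub_nonneg, phiReal_sub_phiReal_Rmap hpy hq]
  have hR := Rmap_mem_Kr hp hpy hq
  refine Finset.sum_nonneg fun y _ => mul_nonneg (hpy y).le ?_
  refine sum_mul_log_sub_mul_log_nonneg (fun j => hR.1 j y) (fun j => hr.1 j y) (fun j h0 => ?_)
    ((hR.2 y).trans (hr.2 y).symm)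
  rw [Rmap_eq hq]
  refine Finset.sum_eq_zero fun x _ => ?_
  by_contra h1
  obtain ⟨h2, h3⟩ := mul_ne_zero_iff.1 h1
  exact h x y j (fun h4 => h2 (by simp [h4])) h3 h0

theorem phiReal_Rmap_le_phi (hp : ∀ x y, 0 ≤ p x y) (hpy : ∀ y, 0 < margY p y) {q : J → X → ℝ}
    (hq : q ∈ Kq S) {r : J → Y → ℝ} (hr : r ∈ Kr J Y) :
    (phiReal p q (Rmap p S q) : EReal) ≤ phi p q r := by
  by_cases h : ∀ x y j, p x y ≠ 0 → q j x ≠ 0 → r j y ≠ 0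
  · rw [phi_eq_phiReal h]
    exact EReal.coe_le_coe_iff.2 (phiReal_Rmap_le hp hpy hq hr h)
  · push Not at h
    obtain ⟨x, y, j, h1, h2, h3⟩ := h
    rw [phi_eq_top hp h1 h2 h3]
    exact le_top

/-- The data-processing inequality for the channel `p_{x|y}`. -/
theorem phiReal_sub_le_condRelEntropy (hp : ∀ x y, 0 ≤ p x y) (hpy : ∀ y, 0 < margY p y)
    {q q' : J → X → ℝ} (hq : q ∈ Kq S) (hq' : q' ∈ Kq S) (h : ∀ j x, q' j x = 0 → q j x = 0) :
    phiReal p q (Rmap p S q') - phiReal p q (Rmap p S q) ≤ condRelEntropy p q q' := by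
  rw [phiReal_sub_phiReal_Rmap hpy hq]
  have key : ∀ y j, margY p y * (Rmap p S q j y * Real.log (Rmap p S q j y)
      - Rmap p S q j y * Real.log (Rmap p S q' j y)) ≤
      ∑ x, p x y * (q j x * Real.log (q j x) - q j x * Real.log (q' j x)) := by
    intro y j
    rw [Rmap_eq hq, Rmap_eq hq']
    refine (mul_le_mul_of_nonneg_left (log_sum_le (fun x => div_nonneg (hp x y) (hpy y).le)
      (hq.1 j) (hq'.1 j) (h j)) (hpy y).le).trans_eq ?_
    rw [Finset.mul_sum]
    refine Finset.sum_congr rfl fun x _ => ?_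
    have := (hpy y).ne'
    field_simp
  simp_rw [Finset.mul_sum]
  refine (Finset.sum_le_sum fun y _ => Finset.sum_le_sum fun j _ => key y j).trans_eq ?_
  rw [Finset.sum_congr rfl fun y _ => Finset.sum_comm, Finset.sum_comm, condRelEntropy]
  refine Finset.sum_congr rfl fun x _ => ?_
  rw [margX, Finset.sum_mul]
  exact Finset.sum_congr rfl fun y _ => (Finset.mul_sum _ _ _).symm

theorem condRelEntropy_nonneg (hpx : ∀ x, 0 < margX p x) {q q' : J → X → ℝ} (hq : q ∈ Kq S)
    (hq' : q' ∈ Kq S) (h : ∀ j x, q' j x = 0 → q j x = 0) : 0 ≤ condRelEntropy p q q' :=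
  Finset.sum_nonneg fun x _ => mul_nonneg (hpx x).le <|
    sum_mul_log_sub_mul_log_nonneg (fun j => hq.1 j x) (fun j => hq'.1 j x) (fun j => h j x)
      ((sum_eq_one_of_mem_Kq hq x).trans (sum_eq_one_of_mem_Kq hq' x).symm)

theorem phiReal_eq_condRelEntropy_Qmap {r : J → Y → ℝ} (hpx : ∀ x, 0 < margX p x)
    (hr : r ∈ Kr J Y) (h : ∀ x y j, x ∈ S j → p x y ≠ 0 → r j y ≠ 0)
    (hcov : ∀ x, ∃ j, x ∈ S j) {q : J → X → ℝ} (hq : q ∈ Kq S) :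
    phiReal p q r = condRelEntropy p q (Qmap p S r)
      - ∑ x, margX p x * Real.log (Afun p S r x) := by
  have hterm : ∀ x j, ∑ y, p x y * (q j x * Real.log (q j x) - q j x * Real.log (r j y)) =
      margX p x * (q j x * Real.log (q j x) - q j x * Real.log (Qmap p S r j x))
        - margX p x * Real.log (Afun p S r x) * q j x := by
    intro x j
    by_cases hj : x ∈ S j
    · have hlog : margX p x * Real.log (Qmap p S r j x) =
          ∑ y, p x y * Real.log (r j y) - margX p x * Real.log (Afun p S r x) := by
        rw [Qmap, if_pos hj, Real.log_div (prod_rpow_pos hr fun y => h x y j hj).ne'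
          (Afun_pos hr h hcov x).ne', log_prod_rpow hr fun y => h x y j hj, mul_sub,
          Finset.mul_sum]
        congr 1
        refine Finset.sum_congr rfl fun y _ => ?_
        have := (hpx x).ne'
        field_simp
      have hsum : ∑ y, p x y * (q j x * Real.log (q j x) - q j x * Real.log (r j y)) =
          margX p x * (q j x * Real.log (q j x)) - q j x * ∑ y, p x y * Real.log (r j y) := by
        rw [margX, Finset.sum_mul, Finset.mul_sum, ← Finset.sum_sub_distrib]
        exact Finset.sum_congr rfl fun y _ => by ring
      rw [hsum]
      linear_combination q j x * hlog
    · simp [hq.2.2 j x hj]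
  rw [phiReal, condRelEntropy, ← Finset.sum_sub_distrib]
  refine Finset.sum_congr rfl fun x _ => ?_
  rw [Finset.sum_comm, Finset.sum_congr rfl fun j _ => hterm x j, Finset.sum_sub_distrib,
    ← Finset.mul_sum, ← Finset.mul_sum, sum_eq_one_of_mem_Kq hq, mul_one]

end Alternating

/-- starting from `q⁽⁰⁾` in the relative interior of `K_q` and alternating
`r⁽ⁿ⁾ := R(q⁽ⁿ⁾)`, `q⁽ⁿ⁺¹⁾ := Q(r⁽ⁿ⁾)`, all `A_x(r⁽ⁿ⁾)` are positive (the iteration is well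
defined), the values `φ(q⁽ⁿ⁾, r⁽ⁿ⁾)` are nonincreasing and converge to
`min_{(q,r) ∈ K_q × K_r} φ(q,r)`. -/
theorem alternating_minimization_converges (X Y J : Type*) [Fintype X] [Fintype Y] [Fintype J]
    [Nonempty X] [Nonempty Y] [DecidableEq X]
    (p : X → Y → ℝ) (S : J → Finset X)
    (hp : ∀ x y, 0 ≤ p x y) (hptot : ∑ x, ∑ y, p x y = 1)
    (hpx : ∀ x, 0 < margX p x) (hpy : ∀ y, 0 < margY p y)
    (hcov : ∀ x, ∃ j, x ∈ S j)
    (q0 : J → X → ℝ) (hq0mem : q0 ∈ Kq S) (hq0pos : ∀ j x, x ∈ S j → 0 < q0 j x)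
    (qs : ℕ → J → X → ℝ) (rs : ℕ → J → Y → ℝ)
    (hinit : qs 0 = q0)
    (hstepR : ∀ n, rs n = Rmap p S (qs n))
    (hstepQ : ∀ n, qs (n + 1) = Qmap p S (rs n)) :
    (∀ n x, 0 < Afun p S (rs n) x) ∧
    (Antitone fun n => phi p (qs n) (rs n)) ∧
    Filter.Tendsto (fun n => phi p (qs n) (rs n)) Filter.atTop
      (nhds (sInf {v : EReal | ∃ q ∈ Kq S, ∃ r ∈ Kr J Y, v = phi p q r})) := by
  subst hinit
  have hsupp : ∀ n, (∀ j x, x ∈ S j → 0 < qs n j x) → qs n ∈ Kq S →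
      ∀ x y j, x ∈ S j → p x y ≠ 0 → rs n j y ≠ 0 := fun n hpos hmem x y j hj hxy => by
    rw [hstepR]
    exact Rmap_ne_zero hp hpy hmem hxy (hpos j x hj).ne'
  have hinv : ∀ n, (∀ j x, x ∈ S j → 0 < qs n j x) ∧ qs n ∈ Kq S := by
    intro n
    induction n with
    | zero => exact ⟨hq0pos, hq0mem⟩
    | succ n ih =>
      have hr : rs n ∈ Kr J Y := hstepR n ▸ Rmap_mem_Kr hp hpy ih.2
      have h := hsupp n ih.1 ih.2
      rw [hstepQ]
      exact ⟨fun j x hj => Qmap_pos hr h hcov hj, Qmap_mem_Kq hr h hcov⟩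
  have hpos := fun n => (hinv n).1
  have hq := fun n => (hinv n).2
  have hr : ∀ n, rs n ∈ Kr J Y := fun n => hstepR n ▸ Rmap_mem_Kr hp hpy (hq n)
  have hs := fun n => hsupp n (hpos n) (hq n)
  have hac : ∀ n {q : J → X → ℝ}, q ∈ Kq S → ∀ j x, qs n j x = 0 → q j x = 0 := by
    intro n q hq' j x h0
    by_cases hj : x ∈ S j
    · exact absurd h0 (hpos n j x hj).ne'
    · exact hq'.2.2 j x hj
  have hphi : ∀ n, phi p (qs n) (rs n) = (phiReal p (qs n) (rs n) : EReal) := fun n => by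
    rw [hstepR]
    exact phi_Rmap hp hpy (hq n)
  have hpyth : ∀ n {q : J → X → ℝ}, q ∈ Kq S → phiReal p q (rs n) =
      condRelEntropy p q (qs (n + 1)) + phiReal p (qs (n + 1)) (rs n) := by
    intro n q hq'
    rw [phiReal_eq_condRelEntropy_Qmap hpx (hr n) (hs n) hcov hq',
      phiReal_eq_condRelEntropy_Qmap hpx (hr n) (hs n) hcov (hq (n + 1)), ← hstepQ,
      condRelEntropy_self]
    ring
  have hdec : ∀ n, phiReal p (qs (n + 1)) (rs (n + 1)) ≤ phiReal p (qs (n + 1)) (rs n) := by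
    intro n
    rw [hstepR (n + 1)]
    refine phiReal_Rmap_le hp hpy (hq _) (hr n) fun x y j hxy hne => hs n x y j ?_ hxy
    by_contra hj
    exact hne ((hq (n + 1)).2.2 j x hj)
  have hanti : Antitone fun n => phi p (qs n) (rs n) := by
    refine antitone_nat_of_succ_le fun n => ?_
    rw [hphi, hphi, EReal.coe_le_coe_iff]
    have h1 := condRelEntropy_nonneg hpx (hq n) (hq (n + 1)) (hac (n + 1) (hq n))
    linarith [hdec n, hpyth n (hq n)]
  refine ⟨fun n => Afun_pos (hr n) (hs n) hcov, hanti, ?_⟩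
  have hlim : sInf {v : EReal | ∃ q ∈ Kq S, ∃ r ∈ Kr J Y, v = phi p q r} =
      ⨅ n, phi p (qs n) (rs n) := by
    refine le_antisymm (le_iInf fun n => sInf_le ⟨qs n, hq n, rs n, hr n, rfl⟩) (le_sInf ?_)
    rintro _ ⟨q, hq', r, hr', rfl⟩
    refine le_trans ?_ (phiReal_Rmap_le_phi hp hpy hq' hr')
    by_contra! hlt
    obtain ⟨c, hc, hc'⟩ := EReal.lt_iff_exists_real_btwn.1 hlt
    have hgap := sub_pos.2 (EReal.coe_lt_coe_iff.1 hc)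
    have hle : ∀ n, c ≤ phiReal p (qs n) (rs n) := fun n => by
      have h1 := hc'.le.trans (iInf_le _ n)
      rwa [hphi, EReal.coe_le_coe_iff] at h1
    have hstep : ∀ n, condRelEntropy p q (qs (n + 1)) + (c - phiReal p q (Rmap p S q)) ≤
        condRelEntropy p q (qs n) := by
      intro n
      have h1 := phiReal_sub_le_condRelEntropy hp hpy hq' (hq n) (hac n hq')
      rw [← hstepR] at h1
      linarith [hpyth n hq', hdec n, hle (n + 1)]
    have htel : ∀ n : ℕ, condRelEntropy p q (qs n) + n * (c - phiReal p q (Rmap p S q)) ≤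
        condRelEntropy p q (qs 0) := by
      intro n
      induction n with
      | zero => simp
      | succ n ih =>
        push_cast
        linarith [hstep n]
    obtain ⟨n, hn⟩ := exists_nat_gt (condRelEntropy p q (qs 0) / (c - phiReal p q (Rmap p S q)))
    rw [div_lt_iff₀ hgap] at hn
    linarith [htel n, condRelEntropy_nonneg hpx hq' (hq n) (hac n hq')]
  rw [hlim]
  exact tendsto_atTop_iInf hanti
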